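/- Let A ⊂ ℤ^d be a spectral set with |A| ≤ 5. Then A admits a rational spectrum, i.e., there exists a spectrum Λ ⊂ ℚ^d ∩ [0,1)^d of A. -/

import Mathlib

open scoped ComplexConjugate

/-- `Λ ⊂ [0,1)^d` is a spectrum of the finite set `A ⊂ ℤ^d` if `|Λ| = |A|` and the
exponentials `a ↦ e^{2πi λ·a}` (`λ ∈ Λ`), restricted to `A`, are pairwise orthogonal
(hence form an orthogonal basis of the functions on `A`). -/
def IsZdSpectrumOf {d : ℕ} (Λ : Finset (Fin d → ℝ)) (A : Finset (Fin d → ℤ)) : Prop :=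
  Λ.card = A.card ∧
  (∀ l ∈ Λ, ∀ i, 0 ≤ l i ∧ l i < 1) ∧
  ∀ l ∈ Λ, ∀ l' ∈ Λ, l ≠ l' →
    ∑ a ∈ A, Complex.exp (2 * Real.pi * Complex.I * (∑ i, l i * (a i : ℝ) : ℝ)) *
      conj (Complex.exp (2 * Real.pi * Complex.I * (∑ i, l' i * (a i : ℝ) : ℝ))) = 0

section Scalar

/-- Two unimodular pairs with equal nonzero sum agree as sets. -/
lemma pair_eq {z1 z2 w1 w2 Z1 Z2 W1 W2 : ℂ} (h1 : z1 * Z1 = 1) (h2 : z2 * Z2 = 1)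
    (k1 : w1 * W1 = 1) (k2 : w2 * W2 = 1) (hs : z1 + z2 = w1 + w2) (hS : Z1 + Z2 = W1 + W2)
    (hne : w1 + w2 ≠ 0) : (z1 = w1 ∧ z2 = w2) ∨ (z1 = w2 ∧ z2 = w1) := by
  have hprod : z1 * z2 = w1 * w2 := by
    have e : (w1 + w2) * (z1 * z2 - w1 * w2) = 0 := by
      have e1 : z1 * z2 * (Z1 + Z2) = w1 + w2 := by
        rw [← hs]; linear_combination z2 * h1 + z1 * h2
      have e2 : w1 * w2 * (Z1 + Z2) = w1 + w2 := by
        rw [hS]; linear_combination w2 * k1 + w1 * k2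
      linear_combination (w1 * w2) * e1 - (z1 * z2) * e2
    rcases mul_eq_zero.1 e with h | h
    · exact absurd h hne
    · linear_combination h
  have : (z1 - w1) * (z1 - w2) = 0 := by linear_combination z1 * hs - hprod
  rcases mul_eq_zero.1 this with h | h
  · left; exact ⟨by linear_combination h, by linear_combination hs - h⟩
  · right; exact ⟨by linear_combination h, by linear_combination hs - h⟩

lemma trick {a b c d x x' y y' A B C D X X' Y Y' : ℂ}
    (hx : x * X = 1) (hx' : x' * X' = 1) (hy : y * Y = 1) (hy' : y' * Y' = 1)
    (s1 : 1 + a + b + x + x' = 0) (S1 : 1 + A + B + X + X' = 0)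
    (s2 : 1 + c + d + y + y' = 0) (S2 : 1 + C + D + Y + Y' = 0)
    (s3 : 1 + A * c + B * d + X * y + X' * y' = 0)
    (S3 : 1 + a * C + b * D + x * Y + x' * Y' = 0) :
    (1 + a + b) * (1 + C + D) * (1 + A * c + B * d) =
      4 - (1 + a + b) * (1 + A + B) - (1 + c + d) * (1 + C + D)
        - (1 + A * c + B * d) * (1 + a * C + b * D) := by
  have e1 : 1 + a + b = -(x + x') := by linear_combination s1
  have e2 : 1 + A + B = -(X + X') := by linear_combination S1
  have e3 : 1 + c + d = -(y + y') := by linear_combination s2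
  have e4 : 1 + C + D = -(Y + Y') := by linear_combination S2
  have e5 : 1 + A * c + B * d = -(X * y + X' * y') := by linear_combination s3
  have e6 : 1 + a * C + b * D = -(x * Y + x' * Y') := by linear_combination S3
  rw [e1, e2, e3, e4, e5, e6]
  have n1 : x ≠ 0 := left_ne_zero_of_mul_eq_one hx
  have n2 : x' ≠ 0 := left_ne_zero_of_mul_eq_one hx'
  have n3 : y ≠ 0 := left_ne_zero_of_mul_eq_one hy
  have n4 : y' ≠ 0 := left_ne_zero_of_mul_eq_one hy'
  rw [eq_inv_of_mul_eq_one_right hx, eq_inv_of_mul_eq_one_right hx',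
    eq_inv_of_mul_eq_one_right hy, eq_inv_of_mul_eq_one_right hy']
  field_simp
  ring

lemma two_equal {a b c d A B C D : ℂ} (ha : a * A = 1) (hb : b * B = 1) (hc : c * C = 1)
    (hd : d * D = 1)
    (e1 : (1 + a + b) * (1 + C + D) * (1 + A * c + B * d) =
      (1 + A + B) * (1 + c + d) * (1 + a * C + b * D))
    (e2 : (1 + a + c) * (1 + B + D) * (1 + A * b + C * d) =
      (1 + A + C) * (1 + b + d) * (1 + a * B + c * D)) :
    (a * d - b) * (a * d - c) * (b - c) = 0 ∧ (b * c - a) * (b * c - d) * (a - d) = 0 := by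
  have n1 : a ≠ 0 := left_ne_zero_of_mul_eq_one ha
  have n2 : b ≠ 0 := left_ne_zero_of_mul_eq_one hb
  have n3 : c ≠ 0 := left_ne_zero_of_mul_eq_one hc
  have n4 : d ≠ 0 := left_ne_zero_of_mul_eq_one hd
  rw [eq_inv_of_mul_eq_one_right ha, eq_inv_of_mul_eq_one_right hb,
    eq_inv_of_mul_eq_one_right hc, eq_inv_of_mul_eq_one_right hd] at e1 e2
  have f1 : (a * d - b) * (a * d - c) * (b - c) + (b * c - a) * (b * c - d) * (a - d) = 0 := by
    field_simp at e1
    first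
    | linear_combination e1
    | linear_combination -e1
  have f2 : (a * d - b) * (a * d - c) * (b - c) - (b * c - a) * (b * c - d) * (a - d) = 0 := by
    field_simp at e2
    linear_combination e2
  constructor
  · linear_combination (f1 + f2) / 2
  · linear_combination (f1 - f2) / 2

lemma fifth {p q s : ℂ} (h : p * q = 1) (hs : p + q = s) (hg : s ^ 2 + s = 1) : p ^ 5 = 1 := by
  subst hs
  have : p ^ 4 + p ^ 3 + p ^ 2 + p + 1 = 0 := by
    linear_combination p ^ 2 * hg - (p + 2 * p ^ 2 + p * q) * h - h
  linear_combination (p - 1) * this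

lemma type_one {a b p q A B P Q : ℂ} (ha : a * A = 1) (hb : b * B = 1) (hp : p * P = 1)
    (hq : q * Q = 1) (s1 : 1 + a + b + p + q = 0) (S1 : 1 + A + B + P + Q = 0)
    (hab : a ≠ b) (hpq : p ≠ q)
    (rel : a + b + A + B + 2 * (A * b + B * a) + 2 = 0)
    (h1 : 1 + a * P + b * Q + p * A + q * B = 0)
    (h2 : 1 + a * Q + b * P + p * B + q * A = 0) : False := by
  have n1 : a ≠ 0 := left_ne_zero_of_mul_eq_one ha
  have n2 : b ≠ 0 := left_ne_zero_of_mul_eq_one hb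
  have e1 : (a - b) * ((p - q) * (a * b + p * q)) = 0 := by
    linear_combination (-(a*b*p*q)) * h1 + (a*b*p*q) * h2
      + (p*q*b*(p-q)) * ha - (p*q*a*(p-q)) * hb + (a*b*q*(a-b)) * hp - a*b*p*(a-b) * hq
  have e2 : a * b + p * q = 0 := by
    simpa [sub_ne_zero.2 hab, sub_ne_zero.2 hpq] using e1
  -- conj of s1 times a b
  have e3 : a * b + (a + b) - (p + q) = 0 := by
    linear_combination (a * b) * S1 - b * ha - a * hb - (P + Q) * e2 + q * hp + p * hq
  have e4 : a * b + 1 + 2 * (a + b) = 0 := by linear_combination e3 + s1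
  have e5 : a * b * (a + b) + (a + b) + 2 * (b ^ 2 + a ^ 2) + 2 * (a * b) = 0 := by
    linear_combination (a * b) * rel - (b + 2 * b^2) * ha - (a + 2 * a^2) * hb
  have e6 : 2 * (a + b) + 1 = 0 := by
    linear_combination (e5 - (a + b) * e4 + 2 * e4) / 2
  have : a * b = 0 := by linear_combination e4 - e6
  simp [n1, n2] at this

lemma type_two {a b p q A B P Q : ℂ} (ha : a * A = 1) (hb : b * B = 1) (hp : p * P = 1)
    (hq : q * Q = 1) (s1 : 1 + a + b + p + q = 0) (S1 : 1 + A + B + P + Q = 0)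
    (hab : a ≠ b) (hpq : p ≠ q)
    (rel : a + b + A + B + 2 * (A * b + B * a) + 2 = 0)
    (h1 : 1 + a * P + b * Q + p * B + q * A = 0)
    (h2 : 1 + a * Q + b * P + p * A + q * B = 0) :
    a ^ 5 = 1 ∧ b ^ 5 = 1 ∧ p ^ 5 = 1 ∧ q ^ 5 = 1 := by
  have e1 : (a - b) * ((p - q) * (a * b - p * q)) = 0 := by
    linear_combination (-(a*b*p*q)) * h1 + (a*b*p*q) * h2
      - (p*q*b*(p-q)) * ha + (p*q*a*(p-q)) * hb + (a*b*q*(a-b)) * hp - a*b*p*(a-b) * hq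
  have e2 : a * b - p * q = 0 := by
    simpa [sub_ne_zero.2 hab, sub_ne_zero.2 hpq] using e1
  have e3 : a * b + (a + b) + (p + q) = 0 := by
    linear_combination (a * b) * S1 - b * ha - a * hb - (P + Q) * e2 - q * hp - p * hq
  have e4 : a * b = 1 := by linear_combination e3 - s1
  have e4' : p * q = 1 := by linear_combination e4 - e2
  have e5 : a * b * (a + b) + (a + b) + 2 * (b ^ 2 + a ^ 2) + 2 * (a * b) = 0 := by
    linear_combination (a * b) * rel - (b + 2 * b^2) * ha - (a + 2 * a^2) * hb
  have e6 : (a + b) ^ 2 + (a + b) = 1 := by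
    linear_combination e5 / 2 - (a + b) / 2 * e4 + e4
  have e7 : (p + q) ^ 2 + (p + q) = 1 := by
    have : p + q = -1 - (a + b) := by linear_combination s1
    rw [this]; linear_combination e6
  exact ⟨fifth e4 rfl e6, fifth (by rw [mul_comm]; exact e4) (add_comm _ _) e6,
    fifth e4' rfl e7, fifth (by rw [mul_comm]; exact e4') (add_comm _ _) e7⟩

lemma no_three {z Z : ℂ} (h : Z = conj z) (hz : z * Z = 1) (n : ℂ) (hn : z + Z + n = 0)
    (h3 : n = 3) : False := by
  subst h h3
  rw [Complex.mul_conj] at hz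
  have h1 : Complex.normSq z = 1 := by exact_mod_cast hz
  rw [Complex.normSq_apply] at h1
  have h2 := congrArg Complex.re hn
  simp at h2
  nlinarith [sq_nonneg z.im]

end Scalar
/-- Complex Hadamard matrices of order five. -/
structure Had (H : Fin 5 → Fin 5 → ℂ) : Prop where
  unit : ∀ i j, H i j * conj (H i j) = 1
  row : ∀ i k, i ≠ k → ∑ j, H i j * conj (H k j) = 0
  col : ∀ j l, j ≠ l → ∑ i, H i j * conj (H i l) = 0

lemma Had.transpose {H : Fin 5 → Fin 5 → ℂ} (h : Had H) : Had (fun i j => H j i) :=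
  ⟨fun i j => h.unit j i, h.col, h.row⟩

lemma Had.reindex {H : Fin 5 → Fin 5 → ℂ} (h : Had H) (σ τ : Equiv.Perm (Fin 5)) :
    Had (fun i j => H (σ i) (τ j)) where
  unit i j := h.unit _ _
  row i k hik := by
    rw [← h.row (σ i) (σ k) (by simpa using hik)]
    exact Equiv.sum_comp τ (fun j => H (σ i) j * conj (H (σ k) j))
  col i k hik := by
    rw [← h.col (τ i) (τ k) (by simpa using hik)]
    exact Equiv.sum_comp σ (fun j => H j (τ i) * conj (H j (τ k)))

lemma Had.scale {H : Fin 5 → Fin 5 → ℂ} (h : Had H) (r c : Fin 5 → ℂ)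
    (hr : ∀ i, r i * conj (r i) = 1) (hc : ∀ i, c i * conj (c i) = 1) :
    Had (fun i j => r i * H i j * c j) where
  unit i j := by
    simp only [map_mul]
    linear_combination (H i j * conj (H i j)) * (c j * conj (c j)) * hr i +
      (c j * conj (c j)) * h.unit i j + hc j
  row i k hik := by
    have := h.row i k hik
    calc _ = ∑ j, (r i * conj (r k)) * (H i j * conj (H k j)) := by
            refine Finset.sum_congr rfl fun j _ => ?_
            simp only [map_mul]
            linear_combination (r i * H i j * conj (r k) * conj (H k j)) * hc j
      _ = 0 := by rw [← Finset.mul_sum, this, mul_zero]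
  col i k hik := by
    have := h.col i k hik
    calc _ = ∑ j, (c i * conj (c k)) * (H j i * conj (H j k)) := by
            refine Finset.sum_congr rfl fun j _ => ?_
            simp only [map_mul]
            linear_combination (c i * H j i * conj (c k) * conj (H j k)) * hr j
      _ = 0 := by rw [← Finset.mul_sum, this, mul_zero]

/-- dephased form -/
noncomputable def deph (H : Fin 5 → Fin 5 → ℂ) : Fin 5 → Fin 5 → ℂ :=
  fun i j => (conj (H i 0) * H 0 0) * H i j * conj (H 0 j)

lemma Had.deph {H : Fin 5 → Fin 5 → ℂ} (h : Had H) : Had (deph H) := by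
  refine h.scale (fun i => conj (H i 0) * H 0 0) (fun j => conj (H 0 j)) ?_ ?_
  · intro i
    simp only [map_mul, Complex.conj_conj]
    linear_combination (H 0 0 * conj (H 0 0)) * h.unit i 0 + h.unit 0 0
  · intro i
    simp only [Complex.conj_conj]
    linear_combination h.unit 0 i

lemma Had.deph_row {H : Fin 5 → Fin 5 → ℂ} (h : Had H) (j) : _root_.deph H 0 j = 1 := by
  simp only [_root_.deph]
  linear_combination (H 0 j * conj (H 0 j)) * h.unit 0 0 + h.unit 0 j

lemma Had.deph_col {H : Fin 5 → Fin 5 → ℂ} (h : Had H) (i) : _root_.deph H i 0 = 1 := by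
  simp only [_root_.deph]
  linear_combination (H 0 0 * conj (H 0 0)) * h.unit i 0 + h.unit 0 0

section Dephased
variable {K : Fin 5 → Fin 5 → ℂ}

lemma row_sum (h : Had K) (h0 : ∀ j, K 0 j = 1) (h1 : ∀ i, K i 0 = 1) (i : Fin 5) (hi : i ≠ 0) :
    1 + K i 1 + K i 2 + K i 3 + K i 4 = 0 := by
  have := h.row i 0 hi
  simpa [Fin.sum_univ_five, h0, h1] using this

lemma row_sum_conj (h : Had K) (h0 : ∀ j, K 0 j = 1) (h1 : ∀ i, K i 0 = 1) (i : Fin 5)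
    (hi : i ≠ 0) :
    1 + conj (K i 1) + conj (K i 2) + conj (K i 3) + conj (K i 4) = 0 := by
  have := congrArg conj (row_sum h h0 h1 i hi)
  simpa using this

lemma row_orth (h : Had K) (h1 : ∀ i, K i 0 = 1) (i k : Fin 5) (hi : i ≠ k) :
    1 + conj (K i 1) * K k 1 + conj (K i 2) * K k 2 + conj (K i 3) * K k 3
      + conj (K i 4) * K k 4 = 0 := by
  have := h.row k i hi.symm
  simpa [Fin.sum_univ_five, h1, mul_comm] using this

lemma trick_K (h : Had K) (h0 : ∀ j, K 0 j = 1) (h1 : ∀ i, K i 0 = 1) :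
    (1 + K 1 1 + K 1 2) * (1 + conj (K 2 1) + conj (K 2 2)) *
      (1 + conj (K 1 1) * K 2 1 + conj (K 1 2) * K 2 2) =
      4 - (1 + K 1 1 + K 1 2) * (1 + conj (K 1 1) + conj (K 1 2))
        - (1 + K 2 1 + K 2 2) * (1 + conj (K 2 1) + conj (K 2 2))
        - (1 + conj (K 1 1) * K 2 1 + conj (K 1 2) * K 2 2) *
          (1 + K 1 1 * conj (K 2 1) + K 1 2 * conj (K 2 2)) := by
  refine trick (h.unit 1 3) (h.unit 1 4) (h.unit 2 3) (h.unit 2 4)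
    (row_sum h h0 h1 1 (by decide)) (row_sum_conj h h0 h1 1 (by decide))
    (row_sum h h0 h1 2 (by decide)) (row_sum_conj h h0 h1 2 (by decide))
    (row_orth h h1 1 2 (by decide)) ?_
  have := row_orth h h1 2 1 (by decide)
  linear_combination this

lemma trick_real (h : Had K) (h0 : ∀ j, K 0 j = 1) (h1 : ∀ i, K i 0 = 1) :
    (1 + K 1 1 + K 1 2) * (1 + conj (K 2 1) + conj (K 2 2)) *
      (1 + conj (K 1 1) * K 2 1 + conj (K 1 2) * K 2 2) =
    (1 + conj (K 1 1) + conj (K 1 2)) * (1 + K 2 1 + K 2 2) *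
      (1 + K 1 1 * conj (K 2 1) + K 1 2 * conj (K 2 2)) := by
  have e := trick_K h h0 h1
  have e' := congrArg conj e
  simp only [map_mul, map_add, map_sub, map_one, Complex.conj_conj, map_ofNat] at e'
  linear_combination e - e'

lemma two_equal_K (h : Had K) (h0 : ∀ j, K 0 j = 1) (h1 : ∀ i, K i 0 = 1) :
    (K 1 1 * K 2 2 - K 1 2) * (K 1 1 * K 2 2 - K 2 1) * (K 1 2 - K 2 1) = 0 ∧
    (K 1 2 * K 2 1 - K 1 1) * (K 1 2 * K 2 1 - K 2 2) * (K 1 1 - K 2 2) = 0 :=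
  two_equal (h.unit 1 1) (h.unit 1 2) (h.unit 2 1) (h.unit 2 2) (trick_real h h0 h1)
    (trick_real h.transpose h1 h0)

lemma rel_aux {a b : ℂ} (ha : a * conj a = 1) (hb : b * conj b = 1)
    (e : (1 + a + b) * (1 + conj b + conj a) * (1 + conj a * b + conj b * a) =
      4 - (1 + a + b) * (1 + conj a + conj b) - (1 + b + a) * (1 + conj b + conj a)
        - (1 + conj a * b + conj b * a) * (1 + a * conj b + b * conj a)) :
    a + b + conj a + conj b + 2 * (conj a * b + conj b * a) + 2 = 0 := by
  have f : (3 + conj a * b + conj b * a) *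
      (a + b + conj a + conj b + 2 * (conj a * b + conj b * a) + 2) = 0 := by
    linear_combination e - (3 + conj a * b + conj b * a) * (ha + hb)
  rcases mul_eq_zero.1 f with h | h
  · exfalso
    refine no_three (z := conj a * b) (Z := conj b * a) (by simp [mul_comm]) ?_ 3 ?_ rfl
    · linear_combination b * conj b * ha + hb
    · linear_combination h
  · exact h

theorem core (h : Had K) (h0 : ∀ j, K 0 j = 1) (h1 : ∀ i, K i 0 = 1)
    (had : K 2 2 = K 1 1) (hbc : K 2 1 = K 1 2) : ∀ i j, K i j ^ 5 = 1 := by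
  have e := trick_K h h0 h1
  rw [had, hbc] at e
  have rel := rel_aux (h.unit 1 1) (h.unit 1 2) e
  have r1 := row_sum h h0 h1 1 (by decide)
  have r1' := row_sum_conj h h0 h1 1 (by decide)
  have r2 := row_sum h h0 h1 2 (by decide)
  have r2' := row_sum_conj h h0 h1 2 (by decide)
  have r3 := row_sum h h0 h1 3 (by decide)
  have r3' := row_sum_conj h h0 h1 3 (by decide)
  have r4 := row_sum h h0 h1 4 (by decide)
  have r4' := row_sum_conj h h0 h1 4 (by decide)
  have c1 := row_sum h.transpose h1 h0 1 (by decide)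
  have c1' := row_sum_conj h.transpose h1 h0 1 (by decide)
  have c2 := row_sum h.transpose h1 h0 2 (by decide)
  have c2' := row_sum_conj h.transpose h1 h0 2 (by decide)
  have c3 := row_sum h.transpose h1 h0 3 (by decide)
  have c3' := row_sum_conj h.transpose h1 h0 3 (by decide)
  have c4 := row_sum h.transpose h1 h0 4 (by decide)
  have c4' := row_sum_conj h.transpose h1 h0 4 (by decide)
  have o12 := row_orth h h1 1 2 (by decide)
  have oc12 := row_orth h.transpose h0 1 2 (by decide)
  have o13 := row_orth h h1 3 1 (by decide)
  have o14 := row_orth h h1 4 1 (by decide)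
  simp only [had, hbc] at r2 r2' c1 c1' c2 c2' o12 oc12
  have u := h.unit
  have ua := u 1 1
  have ub := u 1 2
  have up := u 1 3
  have uq := u 1 4
  -- nondegeneracy
  have nab : K 1 1 ≠ K 1 2 := by
    intro heq
    rw [← heq] at rel
    refine no_three (z := K 1 1) rfl ua 3 ?_ rfl
    linear_combination rel / 2 - 2 * ua
  have nsum : K 1 1 + K 1 2 ≠ 0 := by
    intro heq
    have e1 : K 1 2 = - K 1 1 := by linear_combination heq
    rw [e1] at rel
    simp only [map_neg] at rel
    have : (2 : ℂ) = 0 := by linear_combination -rel - 4 * ua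
    norm_num at this
  have nsum1 : 1 + K 1 1 + K 1 2 ≠ 0 := by
    intro heq
    have heq' := congrArg conj heq
    simp only [map_add, map_one, map_zero] at heq'
    have : (1 : ℂ) = 0 := by
      linear_combination (-1/2 : ℂ) * (rel - heq - heq') +
        (conj (K 1 1) + conj (K 1 2)) * heq - heq' - ua - ub
    norm_num at this
  have nsum2 : K 1 3 + K 1 4 ≠ 0 := by
    intro heq
    exact nsum1 (by linear_combination r1 - heq)
  -- row two
  have row2 := pair_eq (u 2 3) (u 2 4) (u 1 3) (u 1 4)
    (by linear_combination r2 - r1) (by linear_combination r2' - r1') nsum2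
  have row2s : K 2 3 = K 1 4 ∧ K 2 4 = K 1 3 := by
    rcases row2 with ⟨h3, h4⟩ | h
    · exfalso
      rw [h3, h4] at o12
      refine no_three (z := conj (K 1 1) * K 1 2) (Z := conj (K 1 2) * K 1 1)
        (by simp [mul_comm]) ?_ 3 ?_ rfl
      · linear_combination K 1 2 * conj (K 1 2) * ua + ub
      · linear_combination o12 - up - uq
    · exact h
  obtain ⟨h23, h24⟩ := row2s
  have npq : K 1 3 ≠ K 1 4 := by
    intro heq
    rw [h23, h24, ← heq] at o12
    refine no_three (z := conj (K 1 1) * K 1 2) (Z := conj (K 1 2) * K 1 1)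
      (by simp [mul_comm]) ?_ 3 ?_ rfl
    · linear_combination K 1 2 * conj (K 1 2) * ua + ub
    · linear_combination o12 - 2 * up
  -- columns
  have col1 := pair_eq (u 3 1) (u 4 1) (u 1 3) (u 1 4)
    (by linear_combination c1 - r1) (by linear_combination c1' - r1') nsum2
  have col2 := pair_eq (u 3 2) (u 4 2) (u 3 1) (u 4 1)
    (by linear_combination c2 - c1) (by linear_combination c2' - c1')
    (by intro heq; exact nsum2 (by linear_combination r1 - c1 + heq))
  have col2s : K 3 2 = K 4 1 ∧ K 4 2 = K 3 1 := by
    rcases col2 with ⟨h3, h4⟩ | h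
    · exfalso
      rw [h3, h4] at oc12
      refine no_three (z := conj (K 1 1) * K 1 2) (Z := conj (K 1 2) * K 1 1)
        (by simp [mul_comm]) ?_ 3 ?_ rfl
      · linear_combination K 1 2 * conj (K 1 2) * ua + ub
      · linear_combination oc12 - u 3 1 - u 4 1
    · exact h
  obtain ⟨h32, h42⟩ := col2s
  have hs31 : K 3 1 + K 4 1 = K 1 3 + K 1 4 := by linear_combination c1 - r1
  have hs31' : conj (K 3 1) + conj (K 4 1) = conj (K 1 3) + conj (K 1 4) := by
    linear_combination c1' - r1'
  simp only [h23, h24, h32, h42] at r3 r3' r4 r4' c3 c3' c4 c4' o13 o14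
  have blk := pair_eq (u 3 3) (u 3 4) (u 1 1) (u 1 2)
    (by linear_combination r3 - r1 - hs31) (by linear_combination r3' - r1' - hs31') nsum
  have h43 : K 4 3 = K 3 4 := by linear_combination c3 - r3 + hs31
  have h44 : K 4 4 = K 3 3 := by linear_combination c4 - r3 + hs31
  rw [h43, h44] at o14
  have key : K 1 1 ^ 5 = 1 ∧ K 1 2 ^ 5 = 1 ∧ K 1 3 ^ 5 = 1 ∧ K 1 4 ^ 5 = 1 := by
    rcases col1 with ⟨g3, g4⟩ | ⟨g3, g4⟩ <;> rcases blk with ⟨g5, g6⟩ | ⟨g5, g6⟩ <;>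
      rw [g3, g4, g5, g6] at o13 o14
    · exact (type_one ua ub up uq r1 r1' nab npq rel (by linear_combination o13)
        (by linear_combination o14)).elim
    · exact type_two ua ub up uq r1 r1' nab npq rel (by linear_combination o13)
        (by linear_combination o14)
    · exact type_two ua ub up uq r1 r1' nab npq rel (by linear_combination o14)
        (by linear_combination o13)
    · exact (type_one ua ub up uq r1 r1' nab npq rel (by linear_combination o14)
        (by linear_combination o13)).elim
  obtain ⟨k1, k2, k3, k4⟩ := key
  have k31 : K 3 1 ^ 5 = 1 ∧ K 4 1 ^ 5 = 1 := by
    rcases col1 with ⟨g3, g4⟩ | ⟨g3, g4⟩ <;> rw [g3, g4] <;> exact ⟨by assumption, by assumption⟩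
  have k33 : K 3 3 ^ 5 = 1 ∧ K 3 4 ^ 5 = 1 := by
    rcases blk with ⟨g3, g4⟩ | ⟨g3, g4⟩ <;> rw [g3, g4] <;> exact ⟨by assumption, by assumption⟩
  intro i j
  fin_cases i <;> fin_cases j <;>
    simp [h0, h1, had, hbc, h23, h24, h32, h42, h43, h44, k1, k2, k3, k4, k31.1, k31.2,
      k33.1, k33.2]

end Dephased

/-- All cross ratios are fifth roots of unity. -/
def Cross (H : Fin 5 → Fin 5 → ℂ) : Prop :=
  ∀ i j k l, (H i j * H k l) ^ 5 = (H i l * H k j) ^ 5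

lemma cross_of_core {H : Fin 5 → Fin 5 → ℂ} (h : Had H)
    (he : H 0 1 * H 1 2 * H 2 0 = H 0 2 * H 1 0 * H 2 1)
    (ho : H 0 1 * H 1 0 * H 2 2 = H 0 2 * H 1 1 * H 2 0) : Cross H := by
  have u := h.unit
  have nz : ∀ i j, H i j ≠ 0 := fun i j => left_ne_zero_of_mul_eq_one (u i j)
  have ui : ∀ i j, conj (H i j) = (H i j)⁻¹ := fun i j => eq_inv_of_mul_eq_one_right (u i j)
  have hc := core h.deph h.deph_row h.deph_col (by
      simp only [deph, ui]
      have := nz 0 0; have := nz 1 0; have := nz 2 0; have := nz 0 1; have := nz 0 2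
      field_simp
      linear_combination ho) (by
      simp only [deph, ui]
      have := nz 0 0; have := nz 1 0; have := nz 2 0; have := nz 0 1; have := nz 0 2
      field_simp
      linear_combination -he)
  have hf : ∀ i j, H i j ^ 5 * H 0 0 ^ 5 = H i 0 ^ 5 * H 0 j ^ 5 := by
    intro i j
    have := hc i j
    simp only [deph, ui] at this
    have := nz 0 0; have := nz i 0; have := nz 0 j
    field_simp at *
    linear_combination this
  intro i j k l
  have n0 : H 0 0 ^ 5 * H 0 0 ^ 5 ≠ 0 := by simp [nz]
  apply mul_right_cancel₀ n0
  linear_combination (H k l ^ 5 * H 0 0 ^ 5) * hf i j + (H i 0 ^ 5 * H 0 j ^ 5) * hf k l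
    - (H k j ^ 5 * H 0 0 ^ 5) * hf i l - (H i 0 ^ 5 * H 0 l ^ 5) * hf k j

lemma cross_of_reindex {H : Fin 5 → Fin 5 → ℂ} (σ τ : Equiv.Perm (Fin 5))
    (h : Cross (fun i j => H (σ i) (τ j))) : Cross H := by
  intro i j k l
  simpa using h (σ.symm i) (τ.symm j) (σ.symm k) (τ.symm l)

lemma two_equal_H {H : Fin 5 → Fin 5 → ℂ} (h : Had H) :
    (H 0 0 * H 1 1 * H 2 2 = H 0 1 * H 1 2 * H 2 0 ∨
     H 0 0 * H 1 1 * H 2 2 = H 0 2 * H 1 0 * H 2 1 ∨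
     H 0 1 * H 1 2 * H 2 0 = H 0 2 * H 1 0 * H 2 1) ∧
    (H 0 0 * H 1 2 * H 2 1 = H 0 2 * H 1 1 * H 2 0 ∨
     H 0 0 * H 1 2 * H 2 1 = H 0 1 * H 1 0 * H 2 2 ∨
     H 0 1 * H 1 0 * H 2 2 = H 0 2 * H 1 1 * H 2 0) := by
  have u := h.unit
  have nz : ∀ i j, H i j ≠ 0 := fun i j => left_ne_zero_of_mul_eq_one (u i j)
  have ui : ∀ i j, conj (H i j) = (H i j)⁻¹ := fun i j => eq_inv_of_mul_eq_one_right (u i j)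
  obtain ⟨h1, h2⟩ := two_equal_K h.deph h.deph_row h.deph_col
  have := nz 0 0; have := nz 1 0; have := nz 2 0; have := nz 0 1; have := nz 0 2
  simp only [mul_eq_zero, or_assoc, sub_eq_zero, deph, ui] at h1 h2
  constructor
  · rcases h1 with h1 | h1 | h1
    · left; field_simp at h1; linear_combination h1
    · right; left; field_simp at h1; linear_combination h1
    · right; right; field_simp at h1; linear_combination h1
  · rcases h2 with h2 | h2 | h2
    · left; field_simp at h2; linear_combination h2
    · right; left; field_simp at h2; linear_combination h2
    · right; right; field_simp at h2; linear_combination -h2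

/-- cyclic permutation of the first three indices -/
def cyc : Equiv.Perm (Fin 5) := Equiv.swap 0 1 * Equiv.swap 1 2

lemma cyc0 : cyc 0 = 1 := by decide
lemma cyc1 : cyc 1 = 2 := by decide
lemma cyc2 : cyc 2 = 0 := by decide

theorem haagerup {H : Fin 5 → Fin 5 → ℂ} (h : Had H) : Cross H := by
  obtain ⟨h1, h2⟩ := two_equal_H h
  have main : ∃ m n : Fin 3,
      (H ((cyc ^ (m : ℕ)) 0) ((cyc ^ (n : ℕ)) 1) * H ((cyc ^ (m : ℕ)) 1) ((cyc ^ (n : ℕ)) 2) *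
        H ((cyc ^ (m : ℕ)) 2) ((cyc ^ (n : ℕ)) 0) =
       H ((cyc ^ (m : ℕ)) 0) ((cyc ^ (n : ℕ)) 2) * H ((cyc ^ (m : ℕ)) 1) ((cyc ^ (n : ℕ)) 0) *
        H ((cyc ^ (m : ℕ)) 2) ((cyc ^ (n : ℕ)) 1)) ∧
      (H ((cyc ^ (m : ℕ)) 0) ((cyc ^ (n : ℕ)) 1) * H ((cyc ^ (m : ℕ)) 1) ((cyc ^ (n : ℕ)) 0) *
        H ((cyc ^ (m : ℕ)) 2) ((cyc ^ (n : ℕ)) 2) =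
       H ((cyc ^ (m : ℕ)) 0) ((cyc ^ (n : ℕ)) 2) * H ((cyc ^ (m : ℕ)) 1) ((cyc ^ (n : ℕ)) 1) *
        H ((cyc ^ (m : ℕ)) 2) ((cyc ^ (n : ℕ)) 0)) := by
    simp only [Fin.exists_fin_succ, IsEmpty.exists_iff, or_false]
    simp [pow_succ, cyc0, cyc1, cyc2]
    grind
  obtain ⟨m, n, e1, e2⟩ := main
  exact cross_of_reindex (cyc ^ (m : ℕ)) (cyc ^ (n : ℕ))
    (cross_of_core (h.reindex _ _) e1 e2)
section Rational

/-- `e(t) = exp(2 π i t)` -/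
noncomputable def ex (t : ℝ) : ℂ := Complex.exp (2 * Real.pi * Complex.I * (t : ℂ))

lemma ex_add (s t : ℝ) : ex (s + t) = ex s * ex t := by
  simp only [ex, ← Complex.exp_add]; congr 1; push_cast; ring

lemma ex_conj (t : ℝ) : conj (ex t) = ex (-t) := by
  simp only [ex, ← Complex.exp_conj]; congr 1; simp [Complex.conj_ofNat]

lemma ex_zero : ex 0 = 1 := by simp [ex]

lemma ex_ne (t : ℝ) : ex t ≠ 0 := Complex.exp_ne_zero _

lemma ex_unit (t : ℝ) : ex t * conj (ex t) = 1 := by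
  rw [ex_conj, ← ex_add, add_neg_cancel, ex_zero]

lemma ex_int (n : ℤ) : ex n = 1 := by
  rw [ex, Complex.exp_eq_one_iff]; exact ⟨n, by push_cast; ring⟩

lemma ex_eq_one {t : ℝ} (h : ex t = 1) : ∃ n : ℤ, t = n := by
  rw [ex, Complex.exp_eq_one_iff] at h
  obtain ⟨n, hn⟩ := h
  refine ⟨n, ?_⟩
  have hp : (2 * Real.pi * Complex.I : ℂ) ≠ 0 := Complex.two_pi_I_ne_zero
  have : (t : ℂ) = n := by
    apply mul_left_cancel₀ hp
    rw [hn]; ring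
  exact_mod_cast this

lemma ex_pow (t : ℝ) (m : ℕ) : ex t ^ m = ex (m * t) := by
  simp only [ex, ← Complex.exp_nat_mul]; congr 1; push_cast; ring

lemma exists_phi : ∃ φ : ℝ →ₗ[ℚ] ℚ, φ 1 = 1 := by
  obtain ⟨g, hg⟩ := LinearMap.exists_leftInverse_of_injective (Algebra.linearMap ℚ ℝ)
    (by
      rw [LinearMap.ker_eq_bot]
      intro a b hab
      simpa using hab)
  refine ⟨g, ?_⟩
  have := LinearMap.congr_fun hg 1
  simpa using this

lemma phi_rat {φ : ℝ →ₗ[ℚ] ℚ} (h : φ 1 = 1) (q : ℚ) : φ (q : ℝ) = q := by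
  have := φ.map_smul q 1
  rw [h] at this
  simpa [Rat.smul_def] using this

lemma ratio_eq {φ : ℝ →ₗ[ℚ] ℚ} (h : φ 1 = 1) {s t : ℝ} {m : ℕ} (hm : m ≠ 0)
    (hp : ex s ^ m = ex t ^ m) : ex (φ s : ℝ) * ex t = ex (φ t : ℝ) * ex s := by
  rw [ex_pow, ex_pow] at hp
  have h1 : ex (m * s - m * t) = 1 := by
    rw [sub_eq_add_neg, ex_add, hp, ← ex_add, add_neg_cancel, ex_zero]
  obtain ⟨n, hn⟩ := ex_eq_one h1
  have hm' : (m : ℝ) ≠ 0 := by exact_mod_cast hm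
  have hst : s = t + ((n / m : ℚ) : ℝ) := by
    push_cast
    field_simp
    linear_combination hn
  have hphi : φ s = φ t + (n / m : ℚ) := by
    conv_lhs => rw [hst]
    rw [map_add, phi_rat h]
  rw [← ex_add, ← ex_add, hphi]
  congr 1
  rw [hst]; push_cast; ring

lemma pow_case {ι : Type*} {φ : ℝ →ₗ[ℚ] ℚ} (h : φ 1 = 1) (A : Finset ι) (θ : ι → ℝ) {m : ℕ}
    (hm : m ≠ 0) (hp : ∀ a ∈ A, ∀ b ∈ A, ex (θ a) ^ m = ex (θ b) ^ m)
    (hs : ∑ a ∈ A, ex (θ a) = 0) : ∑ a ∈ A, ex (φ (θ a) : ℝ) = 0 := by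
  rcases A.eq_empty_or_nonempty with rfl | ⟨b, hb⟩
  · simp
  have : (∑ a ∈ A, ex (φ (θ a) : ℝ)) * ex (θ b) = ex (φ (θ b) : ℝ) * ∑ a ∈ A, ex (θ a) := by
    rw [Finset.sum_mul, Finset.mul_sum]
    exact Finset.sum_congr rfl fun a ha => ratio_eq h hm (hp a ha b hb)
  rw [hs, mul_zero] at this
  exact (mul_eq_zero.1 this).resolve_right (ex_ne _)

lemma pair_case {φ : ℝ →ₗ[ℚ] ℚ} (h : φ 1 = 1) {s t : ℝ} (hs : ex s + ex t = 0) :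
    ex (φ s : ℝ) + ex (φ t : ℝ) = 0 := by
  have e : ex s = - ex t := by linear_combination hs
  have := ratio_eq h (m := 2) (by norm_num) (s := s) (t := t) (by rw [e]; ring)
  rw [e] at this
  apply mul_right_cancel₀ (ex_ne t)
  linear_combination this

lemma four_pairs {x y z w X Y Z W : ℂ} (hx : x * X = 1) (hy : y * Y = 1) (hz : z * Z = 1)
    (hw : w * W = 1) (s : x + y + z + w = 0) (S : X + Y + Z + W = 0) :
    (x + y = 0 ∧ z + w = 0) ∨ (x + z = 0 ∧ y + w = 0) ∨ (x + w = 0 ∧ y + z = 0) := by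
  by_cases h : x + y = 0
  · exact Or.inl ⟨h, by linear_combination s - h⟩
  · have := pair_eq (z1 := -z) (z2 := -w) (Z1 := -Z) (Z2 := -W) (by linear_combination hz)
      (by linear_combination hw) hx hy (by linear_combination -s) (by linear_combination -S) h
    rcases this with ⟨a, b⟩ | ⟨a, b⟩
    · right; left; exact ⟨by linear_combination -a, by linear_combination -b⟩
    · right; right; exact ⟨by linear_combination -b, by linear_combination -a⟩

lemma small_case {ι : Type*} {φ : ℝ →ₗ[ℚ] ℚ} (h : φ 1 = 1) (A : Finset ι) (θ : ι → ℝ)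
    (hA : A.card ≤ 4) (hs : ∑ a ∈ A, ex (θ a) = 0) : ∑ a ∈ A, ex (φ (θ a) : ℝ) = 0 := by
  classical
  have hcases : A.card = 0 ∨ A.card = 1 ∨ A.card = 2 ∨ A.card = 3 ∨ A.card = 4 := by omega
  rcases hcases with hc | hc | hc | hc | hc
  · rw [Finset.card_eq_zero] at hc; simp [hc]
  · obtain ⟨a, rfl⟩ := Finset.card_eq_one.1 hc
    simp [ex_ne] at hs
  · obtain ⟨a, b, hab, rfl⟩ := Finset.card_eq_two.1 hc
    rw [Finset.sum_pair hab] at hs ⊢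
    exact pair_case h hs
  · obtain ⟨a, b, c, hab, hac, hbc, rfl⟩ := Finset.card_eq_three.1 hc
    refine pow_case h _ θ (m := 3) (by norm_num) ?_ hs
    have hs' : ex (θ a) + ex (θ b) + ex (θ c) = 0 := by
      rw [Finset.sum_insert (by simp [hab, hac]), Finset.sum_pair hbc] at hs
      linear_combination hs
    have hS := congrArg conj hs'
    simp only [map_add, map_zero] at hS
    have ua := ex_unit (θ a)
    have ub := ex_unit (θ b)
    have uc := ex_unit (θ c)
    have e2 : ex (θ a) * ex (θ b) + ex (θ b) * ex (θ c) + ex (θ a) * ex (θ c) = 0 := by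
      linear_combination ex (θ a) * ex (θ b) * ex (θ c) * hS - ex (θ b) * ex (θ c) * ua
        - ex (θ a) * ex (θ c) * ub - ex (θ a) * ex (θ b) * uc
    have key : ∀ x ∈ ({a, b, c} : Finset ι),
        ex (θ x) ^ 3 = ex (θ a) * ex (θ b) * ex (θ c) := by
      intro x hx
      simp only [Finset.mem_insert, Finset.mem_singleton] at hx
      rcases hx with rfl | rfl | rfl
      · linear_combination ex (θ x) ^ 2 * hs' - ex (θ x) * e2
      · linear_combination ex (θ x) ^ 2 * hs' - ex (θ x) * e2
      · linear_combination ex (θ x) ^ 2 * hs' - ex (θ x) * e2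
    intro x hx y hy
    rw [key x hx, key y hy]
  · obtain ⟨a, b, c, d, hab, hac, had, hbc, hbd, hcd, rfl⟩ := Finset.card_eq_four.1 hc
    rw [Finset.sum_insert (by simp [hab, hac, had]), Finset.sum_insert (by simp [hbc, hbd]),
      Finset.sum_pair hcd] at hs ⊢
    have hS := congrArg conj hs
    simp only [map_add, map_zero] at hS
    rcases four_pairs (ex_unit (θ a)) (ex_unit (θ b)) (ex_unit (θ c)) (ex_unit (θ d))
      (by linear_combination hs) (by linear_combination hS) with ⟨p, q⟩ | ⟨p, q⟩ | ⟨p, q⟩ <;>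
      linear_combination pair_case h p + pair_case h q

lemma had_of_rows {H : Fin 5 → Fin 5 → ℂ} (u : ∀ i j, H i j * conj (H i j) = 1)
    (r : ∀ i k, i ≠ k → ∑ j, H i j * conj (H k j) = 0) : Had H := by
  refine ⟨u, r, ?_⟩
  let M : Matrix (Fin 5) (Fin 5) ℂ := Matrix.of H
  let N : Matrix (Fin 5) (Fin 5) ℂ := Matrix.of fun j i => conj (H i j) / 5
  have hMN : M * N = 1 := by
    ext i k
    simp only [M, N, Matrix.mul_apply, Matrix.of_apply, mul_div_assoc', ← Finset.sum_div]
    by_cases hik : i = k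
    · subst hik
      simp [u]
    · rw [r i k hik]; simp [hik]
  have hNM : N * M = 1 := mul_eq_one_comm.1 hMN
  intro j l hjl
  have := congrFun (congrFun hNM l) j
  simp only [M, N, Matrix.mul_apply, Matrix.of_apply, Matrix.one_apply_ne hjl.symm,
    div_mul_eq_mul_div, ← Finset.sum_div] at this
  have h5 : (5 : ℂ) ≠ 0 := by norm_num
  rw [div_eq_zero_iff, or_iff_left h5] at this
  rw [← this]
  exact Finset.sum_congr rfl fun i _ => mul_comm _ _

/-- inner product -/
def dotp {d : ℕ} (l : Fin d → ℝ) (a : Fin d → ℤ) : ℝ := ∑ i, l i * (a i : ℝ)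

lemma dotp_phi {d : ℕ} (φ : ℝ →ₗ[ℚ] ℚ) (l : Fin d → ℝ) (a : Fin d → ℤ) :
    dotp (fun i => (φ (l i) : ℝ)) a = (φ (dotp l a) : ℝ) := by
  simp only [dotp, map_sum]
  push_cast
  refine Finset.sum_congr rfl fun i _ => ?_
  have : l i * (a i : ℝ) = (a i : ℚ) • l i := by
    rw [Rat.smul_def]; push_cast; ring
  rw [this, map_smul]; simp [mul_comm]

lemma ex_dotp_fract {d : ℕ} (l : Fin d → ℝ) (a : Fin d → ℤ) :
    ex (dotp (fun i => Int.fract (l i)) a) = ex (dotp l a) := by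
  have : dotp l a = dotp (fun i => Int.fract (l i)) a + ((∑ i, ⌊l i⌋ * a i : ℤ) : ℝ) := by
    simp only [dotp]
    push_cast
    rw [← Finset.sum_add_distrib]
    refine Finset.sum_congr rfl fun i _ => ?_
    rw [← add_mul, Int.fract_add_floor]
  rw [this, ex_add, ex_int, mul_one]

lemma five_case {d : ℕ} (A : Finset (Fin d → ℤ)) (Λ : Finset (Fin d → ℝ)) (hA : A.card = 5)
    (hΛ : Λ.card = 5)
    (ho : ∀ l ∈ Λ, ∀ l' ∈ Λ, l ≠ l' → ∑ a ∈ A, ex (dotp l a) * conj (ex (dotp l' a)) = 0) :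
    ∀ l ∈ Λ, ∀ l' ∈ Λ, ∀ a ∈ A, ∀ b ∈ A,
      ex (dotp l a - dotp l' a) ^ 5 = ex (dotp l b - dotp l' b) ^ 5 := by
  let f : Fin 5 ≃ A := (A.equivFinOfCardEq hA).symm
  let g : Fin 5 ≃ Λ := (Λ.equivFinOfCardEq hΛ).symm
  have hh : Had (fun i j => ex (dotp (g i : Fin d → ℝ) (f j : Fin d → ℤ))) := by
    apply had_of_rows
    · intro i j; exact ex_unit _
    · intro i k hik
      rw [← ho (g i) (g i).2 (g k) (g k).2 (by
        intro e; exact hik (g.injective (Subtype.ext e)))]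
      rw [Equiv.sum_comp f (fun a : A => ex (dotp (g i : Fin d → ℝ) (a : Fin d → ℤ)) *
        conj (ex (dotp (g k : Fin d → ℝ) (a : Fin d → ℤ))))]
      exact Finset.sum_coe_sort A (fun a => ex (dotp (g i : Fin d → ℝ) a) *
        conj (ex (dotp (g k : Fin d → ℝ) a)))
  intro l hl l' hl' a ha b hb
  have := haagerup hh (g.symm ⟨l, hl⟩) (f.symm ⟨a, ha⟩) (g.symm ⟨l', hl'⟩) (f.symm ⟨b, hb⟩)
  simp only [Equiv.apply_symm_apply] at this
  have e1 : ex (dotp l a) = ex (dotp l a - dotp l' a) * ex (dotp l' a) := by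
    rw [← ex_add]; congr 1; ring
  have e2 : ex (dotp l b) = ex (dotp l b - dotp l' b) * ex (dotp l' b) := by
    rw [← ex_add]; congr 1; ring
  rw [e1, e2] at this
  have n : (ex (dotp l' a) * ex (dotp l' b)) ^ 5 ≠ 0 := pow_ne_zero _ (mul_ne_zero (ex_ne _) (ex_ne _))
  apply mul_right_cancel₀ n
  linear_combination this

end Rational

/-- A spectral set `A ⊂ ℤ^d` with `|A| ≤ 5` admits a rational spectrum. -/
theorem rational_spectrum_of_card_le_five {d : ℕ} (A : Finset (Fin d → ℤ))
    (hcard : A.card ≤ 5) (hspec : ∃ Λ, IsZdSpectrumOf Λ A) :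
    ∃ Λ : Finset (Fin d → ℝ), IsZdSpectrumOf Λ A ∧
      ∀ l ∈ Λ, ∀ i, ∃ q : ℚ, l i = (q : ℝ) := by
  classical
  obtain ⟨Λ, hΛ, -, ho'⟩ := hspec
  have ho : ∀ l ∈ Λ, ∀ l' ∈ Λ, l ≠ l' →
      ∑ a ∈ A, ex (dotp l a) * conj (ex (dotp l' a)) = 0 := ho'
  obtain ⟨φ, hφ⟩ := exists_phi
  let F : (Fin d → ℝ) → (Fin d → ℝ) := fun l i => Int.fract (φ (l i) : ℝ)
  have hF : ∀ l a, ex (dotp (F l) a) = ex (φ (dotp l a) : ℝ) := by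
    intro l a
    rw [← dotp_phi]
    exact ex_dotp_fract (fun i => (φ (l i) : ℝ)) a
  have hsplit : ∀ s t : ℝ, ex s * conj (ex t) = ex (s - t) := by
    intro s t
    rw [ex_conj, ← ex_add, sub_eq_add_neg]
  have orth : ∀ l ∈ Λ, ∀ l' ∈ Λ, l ≠ l' →
      ∑ a ∈ A, ex (dotp (F l) a) * conj (ex (dotp (F l') a)) = 0 := by
    intro l hl l' hl' hne
    have h0 := ho l hl l' hl' hne
    simp only [hsplit] at h0
    have h1 : ∑ a ∈ A, ex (φ (dotp l a - dotp l' a) : ℝ) = 0 := by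
      by_cases h5 : A.card = 5
      · exact pow_case hφ A (fun a => dotp l a - dotp l' a) (m := 5) (by norm_num)
          (five_case A Λ h5 (hΛ.trans h5) ho l hl l' hl') h0
      · exact small_case hφ A (fun a => dotp l a - dotp l' a) (by omega) h0
    rw [← h1]
    refine Finset.sum_congr rfl fun a _ => ?_
    rw [hF, hF, hsplit, map_sub]
    push_cast
    rfl
  have inj : Set.InjOn F Λ := by
    intro l hl l' hl' heq
    by_contra hne
    have h0 := orth l hl l' hl' hne
    rw [heq] at h0
    simp only [ex_unit] at h0
    have hA : A.card = 0 := by simpa using h0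
    rw [hA, Finset.card_eq_zero] at hΛ
    simp [hΛ] at hl
  refine ⟨Λ.image F, ⟨?_, ?_, ?_⟩, ?_⟩
  · rw [Finset.card_image_of_injOn inj, hΛ]
  · intro l hl i
    obtain ⟨l, -, rfl⟩ := Finset.mem_image.1 hl
    exact ⟨Int.fract_nonneg _, Int.fract_lt_one _⟩
  · intro l hl l' hl' hne
    obtain ⟨m, hm, rfl⟩ := Finset.mem_image.1 hl
    obtain ⟨m', hm', rfl⟩ := Finset.mem_image.1 hl'
    exact orth m hm m' hm' (fun e => hne (by rw [e]))
  · intro l hl i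
    obtain ⟨l, -, rfl⟩ := Finset.mem_image.1 hl
    exact ⟨Int.fract (φ (l i)), by simp [F]⟩
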